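/- (Uniform Beta posterior tail bound) Let α, β > 0, n ∈ ℕ, 0 ≤ k ≤ n, with k + α ≥ 2 and n − k + β ≥ 2, and set n' := n + α + β. Let θ be distributed according to Beta(k + α, n − k + β) with μ := (k+α)/n'. Then for every ε > 0, P(|θ − μ| ≥ ε) ≤ 1.25·(n'−2)^{3/2} · e^{−2(n'−2)ε²}. -/

import Mathlib

open MeasureTheory

/-- The Beta function `B(a,b) = Γ(a)Γ(b)/Γ(a+b)`. -/
noncomputable def betaFn (a b : ℝ) : ℝ := Real.Gamma a * Real.Gamma b / Real.Gamma (a + b)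

/-- The density of the `Beta(a,b)` distribution on `[0,1]`: `x^{a−1}(1−x)^{b−1}/B(a,b)`. -/
noncomputable def betaPDF (a b x : ℝ) : ℝ :=
  if 0 ≤ x ∧ x ≤ 1 then x ^ (a - 1) * (1 - x) ^ (b - 1) / betaFn a b else 0

/-- The `Beta(a,b)` probability measure on `ℝ` (supported on `[0,1]`). -/
noncomputable def betaMeasure (a b : ℝ) : Measure ℝ :=
  volume.withDensity fun x => ENNReal.ofReal (betaPDF a b x)

/-- If `F₁` and `F₂` are the first two derivatives of `F₀` and satisfy the Kummer equation
`s F₂ + (c - s) F₁ - a F₀ = 0`, then the logarithmic derivative `F₁ / F₀` obeys a Riccati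
inequality which integrates to a Gaussian bound on `F₀` over the positive half-line. -/
lemma kummer_le_exp_of_nonneg {a c : ℝ} (hc : 0 < c) {F₀ F₁ F₂ : ℝ → ℝ}
    (hpos : ∀ s, 0 < F₀ s) (h₀ : F₀ 0 = 1)
    (hF₀ : ∀ s, HasDerivAt F₀ (F₁ s) s) (hF₁ : ∀ s, HasDerivAt F₁ (F₂ s) s)
    (hode : ∀ s, a * F₀ s - c * F₁ s + s * (F₁ s - F₂ s) = 0) {s : ℝ} (hs : 0 ≤ s) :
    F₀ s ≤ Real.exp (a / c * s + s ^ 2 / (8 * (c + 1))) := by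
  have hcne : c ≠ 0 := hc.ne'
  have hc1 : c + 1 ≠ 0 := by positivity
  have hu (t : ℝ) : HasDerivAt (fun t ↦ F₁ t / F₀ t)
      ((F₂ t * F₀ t - F₁ t * F₁ t) / F₀ t ^ 2) t :=
    (hF₁ t).div (hF₀ t) (hpos t).ne'
  set h : ℝ → ℝ := fun t ↦ t ^ c * (F₁ t / F₀ t - a / c - t / (4 * (c + 1))) with hh
  have hlin (t : ℝ) : HasDerivAt (fun t ↦ F₁ t / F₀ t - a / c - t / (4 * (c + 1)))
      ((F₂ t * F₀ t - F₁ t * F₁ t) / F₀ t ^ 2 - 1 / (4 * (c + 1))) t :=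
    ((hu t).sub_const _).sub ((hasDerivAt_id t).div_const _)
  have hcont : Continuous h :=
    (Real.continuous_rpow_const hc.le).mul
      (continuous_iff_continuousAt.2 fun t ↦ (hlin t).continuousAt)
  have hderiv {t : ℝ} (ht : 0 < t) :=
    (Real.hasDerivAt_rpow_const (p := c) (Or.inl ht.ne')).mul (hlin t)
  have hanti : AntitoneOn h (Set.Ici 0) := by
    refine antitoneOn_of_deriv_nonpos (convex_Ici 0) hcont.continuousOn ?_ ?_
    · intro t ht
      rw [interior_Ici] at ht
      exact (hderiv ht).differentiableAt.differentiableWithinAt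
    · intro t ht
      rw [interior_Ici] at ht
      have ht : 0 < t := ht
      refine (hderiv ht).deriv.trans_le ?_
      have hpow : t ^ c = t ^ (c - 1) * t := by
        rw [← Real.rpow_add_one ht.ne', sub_add_cancel]
      have key : c * t ^ (c - 1) * (F₁ t / F₀ t - a / c - t / (4 * (c + 1))) +
          t ^ c * ((F₂ t * F₀ t - F₁ t * F₁ t) / F₀ t ^ 2 - 1 / (4 * (c + 1))) =
          -(t ^ (c - 1) * t * (F₁ t / F₀ t - 1 / 2) ^ 2) := by
        have hne := (hpos t).ne'
        have hode' : t * F₂ t = a * F₀ t - c * F₁ t + t * F₁ t := by linarith [hode t]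
        have hF₂ : F₂ t = (a * F₀ t - c * F₁ t + t * F₁ t) / t := by
          rw [← hode']; field_simp
        rw [hpow, hF₂]
        field_simp
        ring
      rw [key]
      have := Real.rpow_pos_of_pos ht (c - 1)
      have : 0 ≤ t ^ (c - 1) * t * (F₁ t / F₀ t - 1 / 2) ^ 2 := by positivity
      linarith
  have hle {t : ℝ} (ht : 0 < t) : F₁ t / F₀ t ≤ a / c + t / (4 * (c + 1)) := by
    have h1 : h t ≤ h 0 := hanti Set.self_mem_Ici ht.le ht.le
    simp only [hh, Real.zero_rpow hcne, zero_mul] at h1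
    have := nonpos_of_mul_nonpos_right h1 (Real.rpow_pos_of_pos ht c)
    linarith
  have hk (t : ℝ) : HasDerivAt (fun t ↦ Real.log (F₀ t) - (a / c * t + t ^ 2 / (8 * (c + 1))))
      (F₁ t / F₀ t - (a / c + t / (4 * (c + 1)))) t := by
    have h1 := ((hF₀ t).log (hpos t).ne').sub
      (((hasDerivAt_id t).const_mul (a / c)).add ((hasDerivAt_pow 2 t).div_const (8 * (c + 1))))
    refine h1.congr_deriv ?_
    field_simp
    ring
  have hkanti := antitoneOn_of_deriv_nonpos (convex_Ici (0 : ℝ))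
    (fun t _ ↦ (hk t).continuousAt.continuousWithinAt)
    (fun t _ ↦ (hk t).differentiableAt.differentiableWithinAt)
    (fun t ht ↦ by
      rw [interior_Ici] at ht
      rw [(hk t).deriv]
      linarith [hle ht])
  have := hkanti Set.self_mem_Ici hs hs
  simp only [h₀, Real.log_one] at this
  rw [← Real.log_le_iff_le_exp (hpos s)]
  norm_num at this
  linarith

lemma kummer_le_exp {a c : ℝ} (hc : 0 < c) {F₀ F₁ F₂ : ℝ → ℝ}
    (hpos : ∀ s, 0 < F₀ s) (h₀ : F₀ 0 = 1)
    (hF₀ : ∀ s, HasDerivAt F₀ (F₁ s) s) (hF₁ : ∀ s, HasDerivAt F₁ (F₂ s) s)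
    (hode : ∀ s, a * F₀ s - c * F₁ s + s * (F₁ s - F₂ s) = 0) (s : ℝ) :
    F₀ s ≤ Real.exp (a / c * s + s ^ 2 / (8 * (c + 1))) := by
  obtain hs | hs := le_total 0 s
  · exact kummer_le_exp_of_nonneg hc hpos h₀ hF₀ hF₁ hode hs
  -- The Kummer transformation `s ↦ exp s * F₀ (-s)` exchanges `a` and `c - a`.
  have hneg {G G' : ℝ → ℝ} (hG : ∀ s, HasDerivAt G (G' s) s) (s : ℝ) :
      HasDerivAt (fun s ↦ Real.exp s * G (-s)) (Real.exp s * (G (-s) - G' (-s))) s := by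
    have h1 := (Real.hasDerivAt_exp s).mul ((hG (-s)).scomp s (hasDerivAt_neg s))
    refine h1.congr_deriv ?_
    simp
    ring
  have key := kummer_le_exp_of_nonneg (a := c - a) hc
    (F₀ := fun s ↦ Real.exp s * F₀ (-s))
    (F₁ := fun s ↦ Real.exp s * (F₀ (-s) - F₁ (-s)))
    (F₂ := fun s ↦ Real.exp s * (F₀ (-s) - F₁ (-s) - (F₁ (-s) - F₂ (-s))))
    (fun s ↦ mul_pos (Real.exp_pos s) (hpos _)) (by simp [h₀]) (hneg hF₀)
    (hneg fun t ↦ (hF₀ t).sub (hF₁ t))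
    (fun t ↦ by linear_combination -Real.exp t * hode (-t)) (neg_nonneg.2 hs)
  simp only [neg_neg] at key
  calc F₀ s = Real.exp s * (Real.exp (-s) * F₀ s) := by
        rw [← mul_assoc, ← Real.exp_add]; simp
    _ ≤ Real.exp s * Real.exp ((c - a) / c * -s + (-s) ^ 2 / (8 * (c + 1))) := by gcongr
    _ = Real.exp (a / c * s + s ^ 2 / (8 * (c + 1))) := by
        rw [← Real.exp_add]
        congr 1
        field_simp
        ring

lemma betaMeasure_eq (a b : ℝ) : betaMeasure a b = ProbabilityTheory.betaMeasure a b := by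
  refine withDensity_congr_ae ?_
  filter_upwards [compl_mem_ae_iff.2 (measure_singleton (μ := volume) (0 : ℝ)),
    compl_mem_ae_iff.2 (measure_singleton (μ := volume) (1 : ℝ))] with x hx0 hx1
  have hiff : (0 ≤ x ∧ x ≤ 1) ↔ (0 < x ∧ x < 1) :=
    ⟨fun h ↦ ⟨lt_of_le_of_ne h.1 (Ne.symm hx0), lt_of_le_of_ne h.2 hx1⟩,
      fun h ↦ ⟨h.1.le, h.2.le⟩⟩
  simp only [betaPDF, ProbabilityTheory.betaPDF, ProbabilityTheory.betaPDFReal, hiff]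
  congr 2
  rw [betaFn, ProbabilityTheory.beta]
  ring

lemma measurable_betaPDF (a b : ℝ) : Measurable (betaPDF a b) :=
  Measurable.ite measurableSet_Icc (by fun_prop) (by fun_prop)

lemma betaFn_pos {a b : ℝ} (ha : 0 < a) (hb : 0 < b) : 0 < betaFn a b :=
  ProbabilityTheory.beta_pos ha hb

lemma betaPDF_nonneg {a b : ℝ} (ha : 0 < a) (hb : 0 < b) (x : ℝ) : 0 ≤ betaPDF a b x := by
  unfold betaPDF
  split_ifs with hx
  · have := betaFn_pos ha hb
    have := sub_nonneg.2 hx.2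
    have := hx.1
    positivity
  · exact le_rfl

lemma integral_betaMeasure {a b : ℝ} (ha : 0 < a) (hb : 0 < b) (g : ℝ → ℝ) :
    ∫ x, g x ∂betaMeasure a b =
      (∫ x in (0 : ℝ)..1, x ^ (a - 1) * (1 - x) ^ (b - 1) * g x) / betaFn a b := by
  rw [betaMeasure, integral_withDensity_eq_integral_toReal_smul
    (measurable_betaPDF a b).ennreal_ofReal (by simp),
    intervalIntegral.integral_of_le zero_le_one, ← integral_Icc_eq_integral_Ioc,
    ← integral_div, ← integral_indicator measurableSet_Icc]
  congr 1 with x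
  rw [ENNReal.toReal_ofReal (betaPDF_nonneg ha hb x), smul_eq_mul, betaPDF, Set.indicator]
  simp only [Set.mem_Icc]
  split_ifs <;> ring

lemma ae_mem_Icc_betaMeasure (a b : ℝ) : ∀ᵐ x ∂betaMeasure a b, x ∈ Set.Icc (0 : ℝ) 1 := by
  rw [betaMeasure, ae_withDensity_iff (measurable_betaPDF a b).ennreal_ofReal]
  refine ae_of_all _ fun x hx ↦ ?_
  by_contra h
  exact hx (by rw [betaPDF, if_neg (by exact h), ENNReal.ofReal_zero])

/-- The Stein identity for the Beta distribution, tested against `exp (s x)`. -/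
lemma integral_betaMeasure_stein {a b : ℝ} (ha : 1 ≤ a) (hb : 1 ≤ b) (s : ℝ) :
    ∫ x, (a - (a + b) * x + s * (x * (1 - x))) * Real.exp (s * x) ∂betaMeasure a b = 0 := by
  rw [integral_betaMeasure (by linarith) (by linarith)]
  have hderiv (x : ℝ) : HasDerivAt (fun x : ℝ ↦ x ^ a * (1 - x) ^ b * Real.exp (s * x))
      ((a * x ^ (a - 1) * (1 - x) ^ b - x ^ a * (b * (1 - x) ^ (b - 1))) * Real.exp (s * x) +
        x ^ a * (1 - x) ^ b * (s * Real.exp (s * x))) x := by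
    have h1 := Real.hasDerivAt_rpow_const (x := x) (p := a) (Or.inr ha)
    have h2 := (Real.hasDerivAt_rpow_const (x := 1 - x) (p := b) (Or.inr hb)).scomp x
      ((hasDerivAt_id x).const_sub 1)
    have h3 := ((hasDerivAt_id x).const_mul s).exp
    refine ((h1.mul h2).mul h3).congr_deriv ?_
    simp
    ring
  have hcont : Continuous fun x : ℝ ↦
      (a * x ^ (a - 1) * (1 - x) ^ b - x ^ a * (b * (1 - x) ^ (b - 1))) * Real.exp (s * x) +
        x ^ a * (1 - x) ^ b * (s * Real.exp (s * x)) := by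
    have h1 {p : ℝ} (hp : 0 ≤ p) : Continuous fun x : ℝ ↦ x ^ p := Real.continuous_rpow_const hp
    have h2 {p : ℝ} (hp : 0 ≤ p) : Continuous fun x : ℝ ↦ (1 - x) ^ p :=
      (h1 hp).comp (continuous_const.sub continuous_id)
    have := h1 (p := a) (by linarith)
    have := h1 (p := a - 1) (by linarith)
    have := h2 (p := b) (by linarith)
    have := h2 (p := b - 1) (by linarith)
    fun_prop
  have hint := intervalIntegral.integral_eq_sub_of_hasDerivAt (fun x _ ↦ hderiv x)
    (hcont.intervalIntegrable 0 1)
  rw [Real.zero_rpow (by linarith), sub_self, Real.zero_rpow (by linarith)] at hint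
  rw [div_eq_zero_iff]
  left
  trans ∫ x in (0 : ℝ)..1,
      ((a * x ^ (a - 1) * (1 - x) ^ b - x ^ a * (b * (1 - x) ^ (b - 1))) * Real.exp (s * x) +
        x ^ a * (1 - x) ^ b * (s * Real.exp (s * x)))
  · refine intervalIntegral.integral_congr fun x hx ↦ ?_
    rw [Set.uIcc_of_le zero_le_one] at hx
    have h1 : x ^ a = x ^ (a - 1) * x := by
      rw [← Real.rpow_add_one' hx.1 (by linarith), sub_add_cancel]
    have h2 : (1 - x) ^ b = (1 - x) ^ (b - 1) * (1 - x) := by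
      rw [← Real.rpow_add_one' (sub_nonneg.2 hx.2) (by linarith), sub_add_cancel]
    simp only [h1, h2]
    ring
  · rw [hint]
    ring

lemma isProbabilityMeasure_betaMeasure {a b : ℝ} (ha : 0 < a) (hb : 0 < b) :
    IsProbabilityMeasure (betaMeasure a b) := by
  rw [betaMeasure_eq]
  exact ProbabilityTheory.isProbabilityMeasureBeta ha hb

lemma mgf_betaMeasure_le {a b : ℝ} (ha : 1 ≤ a) (hb : 1 ≤ b) (s : ℝ) :
    ProbabilityTheory.mgf id (betaMeasure a b) s ≤
      Real.exp (a / (a + b) * s + s ^ 2 / (8 * (a + b + 1))) := by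
  have := isProbabilityMeasure_betaMeasure (a := a) (b := b) (by linarith) (by linarith)
  have hexp (t : ℝ) : Integrable (fun x ↦ Real.exp (t * id x)) (betaMeasure a b) :=
    ProbabilityTheory.integrable_exp_mul_of_mem_Icc aemeasurable_id (ae_mem_Icc_betaMeasure a b)
  have hmem (t : ℝ) :
      t ∈ interior (ProbabilityTheory.integrableExpSet id (betaMeasure a b)) := by
    simp only [ProbabilityTheory.integrableExpSet, hexp, Set.ofPred_true, interior_univ,
      Set.mem_univ]
  have hpow (t : ℝ) (n : ℕ) : Integrable (fun x ↦ x ^ n * Real.exp (t * x)) (betaMeasure a b) :=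
    ProbabilityTheory.integrable_pow_mul_exp_of_mem_interior_integrableExpSet (hmem t) n
  have hderiv (n : ℕ) (t : ℝ) :=
    ProbabilityTheory.hasDerivAt_integral_pow_mul_exp_real (hmem t) n
  have hmgf (t : ℝ) : ProbabilityTheory.mgf id (betaMeasure a b) t =
      ∫ x, x ^ 0 * Real.exp (t * x) ∂betaMeasure a b := by
    simp [ProbabilityTheory.mgf]
  rw [hmgf]
  refine kummer_le_exp (by linarith) (fun t ↦ ?_) (by simp) (hderiv 0) (hderiv 1) (fun t ↦ ?_) s
  · exact (ProbabilityTheory.mgf_pos (hexp t)).trans_eq (hmgf t)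
  · rw [← integral_betaMeasure_stein ha hb t]
    calc _ = ∫ x, a * (x ^ 0 * Real.exp (t * x)) - (a + b) * (x ^ 1 * Real.exp (t * x)) +
          t * (x ^ 1 * Real.exp (t * x) - x ^ 2 * Real.exp (t * x)) ∂betaMeasure a b := by
          rw [integral_add (by fun_prop) (by fun_prop), integral_sub (by fun_prop) (by fun_prop),
            integral_const_mul, integral_const_mul, integral_const_mul,
            integral_sub (hpow t 1) (hpow t 2)]
          rfl
      _ = _ := by
          congr 1 with x
          ring

/-- The Beta distribution is sub-Gaussian with the variance proxy `1 / (4 (a + b + 1))`. -/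
lemma hasSubgaussianMGF_betaMeasure {a b : ℝ} (ha : 1 ≤ a) (hb : 1 ≤ b) :
    ProbabilityTheory.HasSubgaussianMGF (fun x ↦ x - a / (a + b))
      (1 / (4 * (a + b + 1))).toNNReal (betaMeasure a b) := by
  have := isProbabilityMeasure_betaMeasure (a := a) (b := b) (by linarith) (by linarith)
  refine ⟨fun t ↦ ProbabilityTheory.integrable_exp_mul_of_mem_Icc (a := 0 - a / (a + b))
    (b := 1 - a / (a + b)) (by fun_prop) ?_, fun t ↦ ?_⟩
  · filter_upwards [ae_mem_Icc_betaMeasure a b] with x hx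
    exact ⟨by linarith [hx.1], by linarith [hx.2]⟩
  · rw [Real.coe_toNNReal _ (by positivity)]
    have h1 : ProbabilityTheory.mgf (fun x ↦ x - a / (a + b)) (betaMeasure a b) t =
        ProbabilityTheory.mgf id (betaMeasure a b) t * Real.exp (-(a / (a + b) * t)) := by
      simp only [ProbabilityTheory.mgf, id, ← integral_mul_const, ← Real.exp_add]
      congr 1 with x
      ring_nf
    rw [h1]
    refine (mul_le_mul_of_nonneg_right (mgf_betaMeasure_le ha hb t) (Real.exp_pos _).le).trans_eq ?_
    rw [← Real.exp_add]
    congr 1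
    field_simp
    ring

/-- Two-sided sub-Gaussian tail bound for the Beta distribution around its mean. -/
lemma betaMeasure_abs_sub_mean_ge_le {a b ε : ℝ} (ha : 1 ≤ a) (hb : 1 ≤ b) (hε : 0 ≤ ε) :
    betaMeasure a b {x | |x - a / (a + b)| ≥ ε} ≤
      ENNReal.ofReal (2 * Real.exp (-2 * (a + b + 1) * ε ^ 2)) := by
  have := isProbabilityMeasure_betaMeasure (a := a) (b := b) (by linarith) (by linarith)
  have hsub := hasSubgaussianMGF_betaMeasure ha hb
  have hconst : -ε ^ 2 / (2 * ((1 / (4 * (a + b + 1))).toNNReal : ℝ)) =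
      -2 * (a + b + 1) * ε ^ 2 := by
    have : 0 < a + b + 1 := by linarith
    rw [Real.coe_toNNReal _ (by positivity)]
    field_simp
    ring
  have h1 := hsub.measure_ge_le hε
  have h2 := hsub.neg.measure_ge_le hε
  rw [hconst] at h1 h2
  refine (ENNReal.le_ofReal_iff_toReal_le (measure_ne_top _ _) (by positivity)).2 ?_
  calc (betaMeasure a b).real {x | |x - a / (a + b)| ≥ ε}
      ≤ (betaMeasure a b).real ({x | ε ≤ x - a / (a + b)} ∪
          {x | ε ≤ (-fun x ↦ x - a / (a + b)) x}) :=
        measureReal_mono fun x (hx : ε ≤ |x - a / (a + b)|) ↦ le_abs.1 hx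
    _ ≤ _ := measureReal_union_le _ _
    _ ≤ 2 * Real.exp (-2 * (a + b + 1) * ε ^ 2) := by linarith

/-- **Uniform Beta posterior tail bound.** Let `α, β > 0`, `0 ≤ k ≤ n`, with `k + α ≥ 2` and
`n − k + β ≥ 2`, and set `n' := n + α + β`.  Let `θ ∼ Beta(k + α, n − k + β)` and
`μ := (k+α)/n'`.  Then for every `ε > 0`,
`P(|θ − μ| ≥ ε) ≤ 1.25·(n'−2)^{3/2}·e^{−2(n'−2)ε²}`. -/
theorem beta_posterior_uniform_tail_bound (α β : ℝ) (hα : 0 < α) (hβ : 0 < β)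
    (n k : ℕ) (hk : k ≤ n) (h1 : 2 ≤ (k : ℝ) + α) (h2 : 2 ≤ (n : ℝ) - (k : ℝ) + β)
    (ε : ℝ) (hε : 0 < ε) :
    betaMeasure ((k : ℝ) + α) ((n : ℝ) - (k : ℝ) + β)
        {x : ℝ | |x - ((k : ℝ) + α) / ((n : ℝ) + α + β)| ≥ ε} ≤
      ENNReal.ofReal
        (1.25 * ((n : ℝ) + α + β - 2) ^ ((3 : ℝ) / 2) *
          Real.exp (-2 * ((n : ℝ) + α + β - 2) * ε ^ 2)) := by
  have hsum : (n : ℝ) + α + β = (k + α) + (n - k + β) := by ring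
  have htail := betaMeasure_abs_sub_mean_ge_le (a := k + α) (b := n - k + β)
    (by linarith) (by linarith) hε.le
  rw [← hsum] at htail
  refine htail.trans (ENNReal.ofReal_le_ofReal ?_)
  have hM : 2 ≤ (n : ℝ) + α + β - 2 := by linarith
  refine mul_le_mul ?_ (Real.exp_le_exp.2 ?_) (Real.exp_pos _).le (by positivity)
  · have : (2 : ℝ) ≤ ((n : ℝ) + α + β - 2) ^ ((3 : ℝ) / 2) :=
      hM.trans (Real.self_le_rpow_of_one_le (by linarith) (by norm_num))
    linarith
  · nlinarith [sq_nonneg ε]
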